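/- Let 0 < p < 1 and α = 1/p - 2. For every g ∈ A^{1,α}(ℂ_+) and every ε > 0 there exists h ∈ H^p(ℂ_+) with ∫_{ℂ_+} |g(x+iy) - h(x+iy)| y^α dx dy < ε; that is, H^p(ℂ_+) is dense in A^{1,α}(ℂ_+) in the A^{1,α}-norm. -/

import Mathlib

open MeasureTheory Real Complex
open scoped ENNReal NNReal

lemma circle_mean (g : ℂ → ℂ) (c : ℂ) (r R : ℝ) (hr : 0 < r) (hrR : r < R)
    (hg : DifferentiableOn ℂ g (Metric.ball c R)) :
    ENNReal.ofReal (2 * π) * ‖g c‖ₑ ≤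
      ∫⁻ θ in Set.Ioo (-π) π, ‖g (circleMap c r θ)‖ₑ := by
  have h1 : DiffContOnCl ℂ g (Metric.ball c |r|) := by
    rw [abs_of_pos hr]
    apply DifferentiableOn.diffContOnCl
    rw [closure_ball _ hr.ne']
    exact hg.mono (Metric.closedBall_subset_ball hrR)
  have h2 := h1.circleAverage
  have hper : Function.Periodic (fun θ => g (circleMap c r θ)) (2 * π) := fun θ => by
    simp only [periodic_circleMap c r θ]
  have h3 := hper.intervalIntegral_add_eq 0 (-π)
  rw [Real.circleAverage_def] at h2
  have e1 : (0:ℝ) + 2 * π = 2 * π := by ring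
  have e2 : -π + 2 * π = π := by ring
  rw [e1, e2] at h3
  rw [h3, intervalIntegral.integral_of_le (by linarith [pi_pos])] at h2
  have h4 : (∫ θ in Set.Ioc (-π) π, g (circleMap c r θ)) = (2 * π) • g c := by
    rw [← h2, smul_smul, mul_inv_cancel₀ (by positivity), one_smul]
  have h5 := enorm_integral_le_lintegral_enorm (μ := volume.restrict (Set.Ioc (-π) π))
    (fun θ => g (circleMap c r θ))
  rw [h4, enorm_smul, Real.enorm_eq_ofReal (by positivity)] at h5
  rwa [← restrict_Ioo_eq_restrict_Ioc] at h5

lemma lint_id (R : ℝ) (hR : 0 < R) :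
    ∫⁻ r in Set.Ioo 0 R, ENNReal.ofReal r = ENNReal.ofReal (R ^ 2 / 2) := by
  rw [← ofReal_integral_eq_lintegral_ofReal, ← integral_Ioc_eq_integral_Ioo,
    ← intervalIntegral.integral_of_le hR.le, integral_id]
  · simp
  · exact (continuous_id.integrableOn_Icc (a := 0) (b := R)).mono_set Set.Ioo_subset_Icc_self
  · filter_upwards [ae_restrict_mem measurableSet_Ioo] with x hx using hx.1.le

lemma disc_mean (g : ℂ → ℂ) (c : ℂ) (R : ℝ) (hR : 0 < R)
    (hg : DifferentiableOn ℂ g (Metric.ball c R)) :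
    ENNReal.ofReal (R ^ 2) * ‖g c‖ₑ ≤ ∫⁻ w in Metric.ball c R, ‖g w‖ₑ := by
  set F : ℂ → ℝ≥0∞ := (Metric.ball c R).indicator (fun w => ‖g w‖ₑ) with hF
  have hFm : Measurable F := by
    classical
    have : F = (Metric.ball c R).piecewise (fun w => ‖g w‖ₑ) (fun _ => 0) :=
      Set.piecewise_eq_indicator.symm
    rw [this]
    exact ContinuousOn.measurable_piecewise hg.continuousOn.enorm continuousOn_const
      Metric.isOpen_ball.measurableSet
  have e0 : ∫⁻ w in Metric.ball c R, ‖g w‖ₑ = ∫⁻ w, F (c + w) := by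
    rw [← lintegral_indicator Metric.isOpen_ball.measurableSet, lintegral_add_left_eq_self F c]
  rw [e0, ← Complex.lintegral_comp_polarCoord_symm, polarCoord_target, Measure.volume_eq_prod,
    ← Measure.prod_restrict, lintegral_prod]
  · calc ENNReal.ofReal (R ^ 2) * ‖g c‖ₑ
        ≤ ENNReal.ofReal (R ^ 2 / 2) * (ENNReal.ofReal (2 * π) * ‖g c‖ₑ) := by
          rw [← mul_assoc, ← ENNReal.ofReal_mul (by positivity)]
          gcongr
          nlinarith [Real.pi_gt_three, sq_nonneg R]
      _ = ∫⁻ r in Set.Ioo 0 R, ENNReal.ofReal r * (ENNReal.ofReal (2 * π) * ‖g c‖ₑ) := by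
          rw [lintegral_mul_const _ (by fun_prop), lint_id R hR]
      _ ≤ ∫⁻ r in Set.Ioo 0 R, ∫⁻ θ in Set.Ioo (-π) π,
            ENNReal.ofReal r • F (c + Complex.polarCoord.symm (r, θ)) := by
          apply setLIntegral_mono' measurableSet_Ioo
          intro r hr
          simp only [smul_eq_mul]
          rw [lintegral_const_mul' _ _ ENNReal.ofReal_ne_top]
          gcongr
          refine (circle_mean g c r R hr.1 hr.2 hg).trans (le_of_eq ?_)
          refine lintegral_congr fun θ => ?_
          have e1 : c + Complex.polarCoord.symm (r, θ) = circleMap c r θ := by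
            rw [Complex.polarCoord_symm_apply, circleMap, Complex.exp_mul_I]
            push_cast; rfl
          rw [e1, hF, Set.indicator_of_mem]
          rw [Metric.mem_ball, Complex.dist_eq]
          simp [circleMap, abs_of_pos hr.1, hr.2]
      _ ≤ _ := lintegral_mono_set (fun r hr => hr.1)
  · apply Measurable.aemeasurable
    simp only [smul_eq_mul]
    refine Measurable.mul (by fun_prop) (hFm.comp ?_)
    apply Measurable.const_add
    have : (Complex.polarCoord.symm : ℝ × ℝ → ℂ) =
      fun p => p.1 * (Real.cos p.2 + Real.sin p.2 * Complex.I) := funext Complex.polarCoord_symm_apply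
    rw [this]
    fun_prop

def upHalf : Set ℂ := {z : ℂ | 0 < z.im}

lemma upHalf_open : IsOpen upHalf := isOpen_lt continuous_const Complex.continuous_im

def coneSet : Set (ℂ × ℂ) := {q | |q.1.re - q.2.re| < q.2.im ∧ q.1.im < 2 * q.2.im}

lemma coneSet_meas : MeasurableSet coneSet := by
  apply IsOpen.measurableSet
  have h1 : IsOpen {q : ℂ × ℂ | |q.1.re - q.2.re| < q.2.im} :=
    isOpen_lt (by fun_prop) (by fun_prop)
  have h2 : IsOpen {q : ℂ × ℂ | q.1.im < 2 * q.2.im} :=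
    isOpen_lt (by fun_prop) (by fun_prop)
  exact h1.inter h2

noncomputable def kk (z w : ℂ) : ℝ≥0∞ := coneSet.indicator 1 (z, w)

noncomputable def GG (g : ℂ → ℂ) (z : ℂ) : ℝ≥0∞ :=
  ∫⁻ w in upHalf, kk z w * (‖g w‖ₑ * ENNReal.ofReal (w.im ^ (-2 : ℝ)))

lemma point_bound (g : ℂ → ℂ) (hg : DifferentiableOn ℂ g upHalf) (z : ℂ) (hz : z ∈ upHalf)
    (s : ℝ) (hs : 0 ≤ s) : ‖g (z + s * Complex.I)‖ₑ ≤ 9 * GG g z := by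
  set c := z + s * Complex.I with hc
  have hz' : 0 < z.im := hz
  have hcim : c.im = z.im + s := by simp [hc]
  have hcre : c.re = z.re := by simp [hc]
  set R := c.im / 2 with hR
  have hR0 : 0 < R := by rw [hR, hcim]; linarith
  have hball : ∀ w ∈ Metric.ball c R, |z.re - w.re| < R ∧ R < w.im ∧ w.im < 3 * R := by
    intro w hw
    rw [Metric.mem_ball, Complex.dist_eq] at hw
    have h1 := (Complex.abs_re_le_norm (w - c)).trans_lt hw
    have h2 := (Complex.abs_im_le_norm (w - c)).trans_lt hw
    rw [Complex.sub_re, hcre] at h1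
    rw [Complex.sub_im, abs_lt] at h2
    refine ⟨by rwa [abs_sub_comm], ?_, ?_⟩ <;> linarith [h2.1, h2.2]
  have hsub : Metric.ball c R ⊆ upHalf := fun w hw => hR0.trans (hball w hw).2.1
  have h1 := disc_mean g c R hR0 (hg.mono hsub)
  have h2 : ∫⁻ w in Metric.ball c R, ‖g w‖ₑ ≤ ENNReal.ofReal (R ^ 2) * (9 * GG g z) := by
    calc ∫⁻ w in Metric.ball c R, ‖g w‖ₑ
        ≤ ∫⁻ w in Metric.ball c R, ENNReal.ofReal (9 * R ^ 2) *
            (kk z w * (‖g w‖ₑ * ENNReal.ofReal (w.im ^ (-2 : ℝ)))) := by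
          apply setLIntegral_mono' Metric.isOpen_ball.measurableSet
          intro w hw
          obtain ⟨b1, b2, b3⟩ := hball w hw
          have hk : kk z w = 1 := by
            rw [kk, Set.indicator_of_mem]; · rfl
            exact ⟨b1.trans b2, by simp only; linarith⟩
          rw [hk, one_mul, mul_left_comm, ← ENNReal.ofReal_mul (by positivity)]
          nth_rw 1 [← mul_one ‖g w‖ₑ]
          gcongr
          rw [← ENNReal.ofReal_one]
          apply ENNReal.ofReal_le_ofReal
          have hw0 : 0 < w.im := hR0.trans b2
          rw [Real.rpow_neg hw0.le, ← div_eq_mul_inv, one_le_div (by positivity)]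
          norm_num
          nlinarith
      _ ≤ ∫⁻ w in upHalf, ENNReal.ofReal (9 * R ^ 2) *
            (kk z w * (‖g w‖ₑ * ENNReal.ofReal (w.im ^ (-2 : ℝ)))) := lintegral_mono_set hsub
      _ = ENNReal.ofReal (R ^ 2) * (9 * GG g z) := by
          rw [lintegral_const_mul' _ _ ENNReal.ofReal_ne_top, mul_comm 9,
            ENNReal.ofReal_mul (by positivity), mul_assoc, GG]
          norm_num
  have h3 := h1.trans h2
  rwa [ENNReal.mul_le_mul_iff_right (by simpa using hR0.ne') ENNReal.ofReal_ne_top] at h3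

lemma inner_bound (α : ℝ) (hα : -1 < α) (w : ℂ) (hw : w ∈ upHalf) :
    ∫⁻ z in upHalf, kk z w * ENNReal.ofReal (z.im ^ α) ≤
      ENNReal.ofReal (2 * 2 ^ (α + 1) / (α + 1)) * ENNReal.ofReal (w.im ^ (α + 2)) := by
  have hw' : 0 < w.im := hw
  set A := Set.Ioo (w.re - w.im) (w.re + w.im)
  set B := Set.Ioo 0 (2 * w.im)
  have hAB : MeasurableSet (A ×ˢ B) := measurableSet_Ioo.prod measurableSet_Ioo
  have hpre : MeasurableSet (Complex.measurableEquivRealProd ⁻¹' (A ×ˢ B)) :=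
    Complex.measurableEquivRealProd.measurable hAB
  have e1 : ∫⁻ z in upHalf, kk z w * ENNReal.ofReal (z.im ^ α) ≤
      ∫⁻ z in Complex.measurableEquivRealProd ⁻¹' (A ×ˢ B),
        (fun p : ℝ × ℝ => ENNReal.ofReal (p.2 ^ α)) (Complex.measurableEquivRealProd z) := by
    rw [← lintegral_indicator upHalf_open.measurableSet, ← lintegral_indicator hpre]
    apply lintegral_mono
    intro z
    simp only
    by_cases hz : z ∈ upHalf
    · rw [Set.indicator_of_mem hz]
      by_cases hk : (z, w) ∈ coneSet
      · rw [kk, Set.indicator_of_mem hk, Set.indicator_of_mem]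
        · simp
        · obtain ⟨k1, k2⟩ := hk
          simp only [abs_lt] at k1 k2
          have hz' : 0 < z.im := hz
          simp only [Set.mem_preimage, Set.mem_prod, A, B, Set.mem_Ioo, Complex.measurableEquivRealProd_apply]
          refine ⟨⟨?_, ?_⟩, hz', k2⟩ <;> linarith [k1.1, k1.2]
      · rw [kk, Set.indicator_of_notMem hk]; simp
    · rw [Set.indicator_of_notMem hz]; simp
  refine e1.trans ?_
  rw [Complex.volume_preserving_equiv_real_prod.setLIntegral_comp_preimage_emb
    Complex.measurableEquivRealProd.measurableEmbedding (fun p : ℝ × ℝ => ENNReal.ofReal (p.2 ^ α)),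
    Measure.volume_eq_prod, ← Measure.prod_restrict]
  have e2 := lintegral_prod_mul (μ := (volume : Measure ℝ).restrict A)
    (ν := (volume : Measure ℝ).restrict B)
    (f := fun _ => 1) (g := fun y => ENNReal.ofReal (y ^ α)) (by fun_prop) (by fun_prop)
  simp only [one_mul] at e2
  rw [e2]
  have e3 : ∫⁻ y in B, ENNReal.ofReal (y ^ α) =
      ENNReal.ofReal ((2 * w.im) ^ (α + 1) / (α + 1)) := by
    rw [← ofReal_integral_eq_lintegral_ofReal, ← integral_Ioc_eq_integral_Ioo,
      ← intervalIntegral.integral_of_le (by positivity), integral_rpow (Or.inl hα)]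
    · rw [Real.zero_rpow (by linarith), sub_zero]
    · have := intervalIntegral.intervalIntegrable_rpow' hα (a := 0) (b := 2 * w.im)
      rw [intervalIntegrable_iff_integrableOn_Ioo_of_le (by positivity)] at this
      exact this
    · filter_upwards [ae_restrict_mem measurableSet_Ioo] with x hx
      exact Real.rpow_nonneg hx.1.le _
  rw [e3]
  simp only [lintegral_const, Measure.restrict_apply MeasurableSet.univ, Set.univ_inter, one_mul, A,
    Real.volume_Ioo]
  have hα1 : 0 < α + 1 := by linarith
  rw [← ENNReal.ofReal_mul (by linarith), ← ENNReal.ofReal_mul (by positivity)]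
  apply ENNReal.ofReal_le_ofReal
  apply le_of_eq
  have e4 : w.im ^ (α + 2) = w.im ^ (α + 1) * w.im := by
    rw [← Real.rpow_add_one hw'.ne']; congr 1; ring
  rw [Real.mul_rpow (by norm_num) hw'.le, e4]
  ring

lemma enorm_meas (g : ℂ → ℂ) (hg : DifferentiableOn ℂ g upHalf) :
    AEMeasurable (fun w => ‖g w‖ₑ) (volume.restrict upHalf) :=
  hg.continuousOn.enorm.aemeasurable upHalf_open.measurableSet

lemma kk_meas : Measurable (fun q : ℂ × ℂ => kk q.1 q.2) :=
  measurable_one.indicator coneSet_meas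

lemma GG_int (g : ℂ → ℂ) (hg : DifferentiableOn ℂ g upHalf) (α : ℝ) (hα : -1 < α)
    (hfin : ∫⁻ z in upHalf, ‖g z‖ₑ * ENNReal.ofReal (z.im ^ α) < ⊤) :
    ∫⁻ z in upHalf, GG g z * ENNReal.ofReal (z.im ^ α) < ⊤ := by
  have hm : AEMeasurable (fun w : ℂ => ‖g w‖ₑ * ENNReal.ofReal (w.im ^ (-2 : ℝ)))
      (volume.restrict upHalf) := (enorm_meas g hg).mul (by fun_prop)
  calc ∫⁻ z in upHalf, GG g z * ENNReal.ofReal (z.im ^ α)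
      = ∫⁻ z in upHalf, ∫⁻ w in upHalf,
        (kk z w * (‖g w‖ₑ * ENNReal.ofReal (w.im ^ (-2 : ℝ)))) * ENNReal.ofReal (z.im ^ α) := by
        refine lintegral_congr fun z => ?_
        rw [lintegral_mul_const' _ _ ENNReal.ofReal_ne_top, GG]
    _ = ∫⁻ w in upHalf, ∫⁻ z in upHalf,
        (kk z w * (‖g w‖ₑ * ENNReal.ofReal (w.im ^ (-2 : ℝ)))) * ENNReal.ofReal (z.im ^ α) := by
        apply lintegral_lintegral_swap
        refine AEMeasurable.mul (AEMeasurable.mul kk_meas.aemeasurable ?_) (by fun_prop)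
        exact hm.comp_snd
    _ ≤ ∫⁻ w in upHalf, ENNReal.ofReal (2 * 2 ^ (α + 1) / (α + 1)) *
          (‖g w‖ₑ * ENNReal.ofReal (w.im ^ α)) := by
        apply setLIntegral_mono' upHalf_open.measurableSet
        intro w hw
        have hw' : 0 < w.im := hw
        calc ∫⁻ z in upHalf,
            (kk z w * (‖g w‖ₑ * ENNReal.ofReal (w.im ^ (-2 : ℝ)))) * ENNReal.ofReal (z.im ^ α)
            = ∫⁻ z in upHalf, (‖g w‖ₑ * ENNReal.ofReal (w.im ^ (-2 : ℝ))) *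
                (kk z w * ENNReal.ofReal (z.im ^ α)) := by
              refine lintegral_congr fun z => ?_
              ring
          _ = (‖g w‖ₑ * ENNReal.ofReal (w.im ^ (-2 : ℝ))) *
                ∫⁻ z in upHalf, (kk z w * ENNReal.ofReal (z.im ^ α)) :=
              lintegral_const_mul' _ _ (ENNReal.mul_ne_top enorm_ne_top ENNReal.ofReal_ne_top)
          _ ≤ (‖g w‖ₑ * ENNReal.ofReal (w.im ^ (-2 : ℝ))) *
              (ENNReal.ofReal (2 * 2 ^ (α + 1) / (α + 1)) * ENNReal.ofReal (w.im ^ (α + 2))) := by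
              gcongr
              exact inner_bound α hα w hw
          _ = ENNReal.ofReal (2 * 2 ^ (α + 1) / (α + 1)) *
              (‖g w‖ₑ * (ENNReal.ofReal (w.im ^ (-2 : ℝ)) * ENNReal.ofReal (w.im ^ (α + 2)))) := by
              ring
          _ = _ := by
              rw [← ENNReal.ofReal_mul (by positivity), ← Real.rpow_add hw']
              congr 4
              ring_nf
    _ < ⊤ := by
        rw [lintegral_const_mul' _ _ ENNReal.ofReal_ne_top]
        exact ENNReal.mul_lt_top ENNReal.ofReal_lt_top hfin

lemma GG_bdd (g : ℂ → ℂ) (p : ℝ) (hp0 : 0 < p) (δ : ℝ) (hδ : 0 < δ) (z : ℂ) (hz : δ ≤ z.im) :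
    GG g z ≤ ENNReal.ofReal ((δ / 2) ^ (-(1 / p))) *
      ∫⁻ z in upHalf, ‖g z‖ₑ * ENNReal.ofReal (z.im ^ (1 / p - 2)) := by
  rw [← lintegral_const_mul' _ _ ENNReal.ofReal_ne_top, GG]
  apply setLIntegral_mono' upHalf_open.measurableSet
  intro w hw
  have hw' : 0 < w.im := hw
  by_cases hk : (z, w) ∈ coneSet
  · rw [kk, Set.indicator_of_mem hk, Pi.one_apply, one_mul, mul_left_comm,
      ← ENNReal.ofReal_mul (by positivity)]
    gcongr
    have h2 : δ / 2 ≤ w.im := by have := hk.2; simp only at this; linarith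
    calc w.im ^ (-2 : ℝ) = w.im ^ (-(1 / p)) * w.im ^ (1 / p - 2) := by
          rw [← Real.rpow_add hw']; congr 1; ring
      _ ≤ _ := by
          gcongr ?_ * _
          apply Real.rpow_le_rpow_of_nonpos (by positivity) h2
          have : 0 < 1 / p := by positivity
          linarith
  · rw [kk, Set.indicator_of_notMem hk]; simp

lemma denom_bound (δ : ℝ) (hδ : 0 < δ) (z : ℂ) (hz : 0 < z.im) :
    1 + (δ * z.re) ^ 2 ≤ ‖1 - δ * Complex.I * z‖ ^ 2 := by
  rw [← Complex.normSq_eq_norm_sq, Complex.normSq_apply]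
  simp
  have : 0 < δ * z.im := by positivity
  nlinarith

lemma denom_ge_one (δ : ℝ) (hδ : 0 < δ) (z : ℂ) (hz : 0 < z.im) :
    1 ≤ ‖1 - δ * Complex.I * z‖ := by
  have := denom_bound δ hδ z hz
  nlinarith [norm_nonneg (1 - δ * Complex.I * z), sq_nonneg (δ * z.re)]

noncomputable def hh (g : ℂ → ℂ) (N : ℕ) (δ : ℝ) (z : ℂ) : ℂ :=
  g (z + δ * Complex.I) / (1 - δ * Complex.I * z) ^ N

lemma shift_mem (δ : ℝ) (hδ : 0 < δ) (z : ℂ) (hz : z ∈ upHalf) :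
    z + δ * Complex.I ∈ upHalf := by
  have hz' : 0 < z.im := hz
  change 0 < (z + δ * Complex.I).im
  simp; linarith

lemma hh_diff (g : ℂ → ℂ) (hg : DifferentiableOn ℂ g upHalf) (N : ℕ) (δ : ℝ) (hδ : 0 < δ) :
    DifferentiableOn ℂ (hh g N δ) upHalf := by
  apply DifferentiableOn.div
  · exact hg.comp (by fun_prop) (fun z hz => shift_mem δ hδ z hz)
  · fun_prop
  · intro z hz
    apply pow_ne_zero
    have := denom_ge_one δ hδ z hz
    exact norm_pos_iff.mp (by linarith)

lemma hh_le (g : ℂ → ℂ) (hg : DifferentiableOn ℂ g upHalf) (N : ℕ) (δ : ℝ) (hδ : 0 < δ)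
    (z : ℂ) (hz : z ∈ upHalf) : ‖hh g N δ z‖ₑ ≤ 9 * GG g z := by
  refine le_trans ?_ (point_bound g hg z hz δ hδ.le)
  rw [enorm_le_iff_norm_le, hh, norm_div, norm_pow]
  exact div_le_self (norm_nonneg _) (one_le_pow₀ (denom_ge_one δ hδ z hz))

lemma hh_hardy (g : ℂ → ℂ) (hg : DifferentiableOn ℂ g upHalf) (p : ℝ) (hp0 : 0 < p)
    (hfin : ∫⁻ z in upHalf, ‖g z‖ₑ * ENNReal.ofReal (z.im ^ (1 / p - 2)) < ⊤)
    (N : ℕ) (hN : 2 ≤ N * p) (δ : ℝ) (hδ : 0 < δ) :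
    (⨆ (y : ℝ) (_ : 0 < y), ∫⁻ x : ℝ, (‖hh g N δ (x + y * Complex.I)‖₊ : ℝ≥0∞) ^ p) < ⊤ := by
  set B' : ℝ≥0∞ := 9 * (ENNReal.ofReal ((δ / 2) ^ (-(1 / p))) *
      ∫⁻ z in upHalf, ‖g z‖ₑ * ENNReal.ofReal (z.im ^ (1 / p - 2))) with hB'
  have hBt : B' ≠ ⊤ := ENNReal.mul_ne_top (by norm_num)
    (ENNReal.mul_ne_top ENNReal.ofReal_ne_top hfin.ne)
  set B := B'.toReal
  have hB0 : 0 ≤ B := ENNReal.toReal_nonneg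
  have hgB : ∀ z ∈ upHalf, ‖g (z + δ * Complex.I)‖ ≤ B := by
    intro z hz
    have h0 := point_bound g hg _ (shift_mem δ hδ z hz) 0 le_rfl
    simp only [Complex.ofReal_zero, zero_mul, add_zero] at h0
    have hz' : 0 < z.im := hz
    have h1 := GG_bdd g p hp0 δ hδ (z + δ * Complex.I) (by simp; linarith)
    have h2 : ‖g (z + δ * Complex.I)‖ₑ ≤ B' := h0.trans (by rw [hB']; gcongr)
    rw [← toReal_enorm]
    exact ENNReal.toReal_mono hBt h2
  have hint : Integrable (fun x : ℝ => B ^ p * (1 + (δ * x) ^ 2)⁻¹) :=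
    (integrable_inv_one_add_sq.comp_mul_left' hδ.ne').const_mul _
  have hlt : ∫⁻ x : ℝ, ENNReal.ofReal (B ^ p * (1 + (δ * x) ^ 2)⁻¹) < ⊤ := hint.lintegral_lt_top
  refine lt_of_le_of_lt (iSup₂_le fun y hy => ?_) hlt
  apply lintegral_mono
  intro x
  simp only
  have hz : ((x : ℂ) + y * Complex.I) ∈ upHalf := by
    change 0 < ((x : ℂ) + y * Complex.I).im
    simpa using hy
  set z := (x : ℂ) + y * Complex.I with hzdef
  have hre : z.re = x := by simp [hzdef]
  have d1 := denom_bound δ hδ z hz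
  have d2 := denom_ge_one δ hδ z hz
  rw [hre] at d1
  rw [← enorm_eq_nnnorm, ← ofReal_norm, ENNReal.ofReal_rpow_of_nonneg (norm_nonneg _) hp0.le]
  apply ENNReal.ofReal_le_ofReal
  rw [hh, norm_div, norm_pow, Real.div_rpow (norm_nonneg _) (by positivity), ← div_eq_mul_inv]
  have d3 : 1 + (δ * x) ^ 2 ≤ (‖1 - δ * Complex.I * z‖ ^ N) ^ p := by
    rw [← Real.rpow_natCast _ N, ← Real.rpow_mul (norm_nonneg _)]
    refine d1.trans ?_
    rw [← Real.rpow_two]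
    exact Real.rpow_le_rpow_of_exponent_le d2 hN
  have := hgB z hz
  gcongr

lemma hh_tendsto (g : ℂ → ℂ) (hg : DifferentiableOn ℂ g upHalf) (N : ℕ) (z : ℂ) (hz : z ∈ upHalf) :
    Filter.Tendsto (fun n : ℕ => hh g N (1 / ((n : ℝ) + 1)) z) Filter.atTop (nhds (g z)) := by
  have h0 : Filter.Tendsto (fun n : ℕ => (1 / ((n : ℝ) + 1))) Filter.atTop (nhds 0) :=
    tendsto_one_div_add_atTop_nhds_zero_nat
  have hc : ContinuousAt (fun δ : ℝ => hh g N δ z) 0 := by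
    unfold hh
    apply ContinuousAt.div
    · have hgc : ContinuousAt g (z + ((0 : ℝ) : ℂ) * Complex.I) := by
        simpa using (hg.differentiableAt (upHalf_open.mem_nhds hz)).continuousAt
      exact ContinuousAt.comp (f := fun δ : ℝ => z + (δ : ℂ) * Complex.I) hgc (by fun_prop)
    · fun_prop
    · simp
  have := hc.tendsto.comp h0
  simpa [hh, Function.comp_def] using this

/-- For `0 < p < 1` and `α = 1/p - 2`, the Hardy space `Hᵖ(ℂ₊)` is dense in the
weighted Bergman space `A^{1,α}(ℂ₊)` in the `A^{1,α}`-norm. -/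
theorem hardy_dense_in_bergman_halfplane (p : ℝ) (hp0 : 0 < p) (hp1 : p < 1) :
    ∀ g : ℂ → ℂ, DifferentiableOn ℂ g {z : ℂ | 0 < z.im} →
      (∫⁻ z in {z : ℂ | 0 < z.im},
          (‖g z‖₊ : ℝ≥0∞) * ENNReal.ofReal (z.im ^ (1 / p - 2))) < ⊤ →
      ∀ ε : ℝ, 0 < ε → ∃ h : ℂ → ℂ,
        DifferentiableOn ℂ h {z : ℂ | 0 < z.im} ∧
        (⨆ (y : ℝ) (_ : 0 < y), ∫⁻ x : ℝ, (‖h (x + y * Complex.I)‖₊ : ℝ≥0∞) ^ p) < ⊤ ∧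
        (∫⁻ z in {z : ℂ | 0 < z.im},
            (‖g z - h z‖₊ : ℝ≥0∞) * ENNReal.ofReal (z.im ^ (1 / p - 2))) <
          ENNReal.ofReal ε := by
  intro g hg hfin ε hε
  change DifferentiableOn ℂ g upHalf at hg
  change ∫⁻ z in upHalf, ‖g z‖ₑ * ENNReal.ofReal (z.im ^ (1 / p - 2)) < ⊤ at hfin
  have hα : -1 < 1 / p - 2 := by
    have : 1 < 1 / p := by rw [lt_div_iff₀ hp0]; linarith
    linarith
  obtain ⟨N, hN⟩ := exists_nat_ge (2 / p)
  rw [div_le_iff₀ hp0] at hN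
  have hG := GG_int g hg _ hα hfin
  have hpos : ∀ n : ℕ, (0 : ℝ) < 1 / ((n : ℝ) + 1) := fun n => by positivity
  have hlim : Filter.Tendsto (fun n : ℕ => ∫⁻ z in upHalf,
      ‖g z - hh g N (1 / ((n : ℝ) + 1)) z‖ₑ * ENNReal.ofReal (z.im ^ (1 / p - 2)))
      Filter.atTop (nhds (∫⁻ _ in upHalf, 0)) := by
    apply tendsto_lintegral_of_dominated_convergence'
      (fun z => 18 * (GG g z * ENNReal.ofReal (z.im ^ (1 / p - 2))))
    · intro n
      exact (enorm_meas _ (hg.sub (hh_diff g hg N _ (hpos n)))).mul (by fun_prop)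
    · intro n
      filter_upwards [ae_restrict_mem upHalf_open.measurableSet] with z hz
      rw [← mul_assoc]
      gcongr
      have h1 := point_bound g hg z hz 0 le_rfl
      simp only [Complex.ofReal_zero, zero_mul, add_zero] at h1
      calc ‖g z - hh g N (1 / ((n : ℝ) + 1)) z‖ₑ
          ≤ ‖g z‖ₑ + ‖hh g N (1 / ((n : ℝ) + 1)) z‖ₑ := enorm_sub_le
        _ ≤ 9 * GG g z + 9 * GG g z := add_le_add h1 (hh_le g hg N _ (hpos n) z hz)
        _ = 18 * GG g z := by ring
    · rw [lintegral_const_mul' _ _ (by norm_num)]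
      exact ENNReal.mul_ne_top (by norm_num) hG.ne
    · filter_upwards [ae_restrict_mem upHalf_open.measurableSet] with z hz
      have h1 := (tendsto_const_nhds (x := g z)).sub (hh_tendsto g hg N z hz)
      have h2 := h1.enorm
      have h3 := ENNReal.Tendsto.mul_const (b := ENNReal.ofReal (z.im ^ (1 / p - 2))) h2
        (Or.inr ENNReal.ofReal_ne_top)
      simpa using h3
  rw [lintegral_zero] at hlim
  obtain ⟨n, hn⟩ := (hlim.eventually_lt_const (ENNReal.ofReal_pos.mpr hε)).exists
  exact ⟨hh g N (1 / ((n : ℝ) + 1)), hh_diff g hg N _ (hpos n),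
    hh_hardy g hg p hp0 hfin N hN _ (hpos n), hn⟩
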